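/- arXiv:1302.0982 — 2 statements merged into one kernel-verified Lean document; each statement's English description precedes it below -/
import Mathlib

section
/- Let p ≥ 1, s ≥ 2, k ≥ 2, and q ≥ s−1 be integers, and let M = Mon⟨a,b : a^p b^{q+s} a^{pk} b^s = b⟩. Writing x for the element of M represented by the word a^{pk} b^s, the equality a^p x b^{q+1} = x b^{q−(s−1)} x (b^{q+s−1} x)^{k−1} holds in M. -/
open Relation FreeMonoid

/-- Words over the alphabet `A`: the free monoid on `A`. -/
abbrev Word (A : Type) : Type := FreeMonoid A

/-- One-step rewriting relation of the rewriting system `R`. -/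
def OneStep {A : Type} (R : Set (Word A × Word A)) (x y : Word A) : Prop :=
  ∃ u v l r : Word A, (l, r) ∈ R ∧ x = u * l * v ∧ y = u * r * v

/-- Confluence of the rewriting system `R`. -/
def IsConfluent {A : Type} (R : Set (Word A × Word A)) : Prop :=
  ∀ w x y : Word A, ReflTransGen (OneStep R) w x → ReflTransGen (OneStep R) w y →
    ∃ z : Word A, ReflTransGen (OneStep R) x z ∧ ReflTransGen (OneStep R) y z

/-- Termination of the rewriting system `R`: no infinite rewriting chain. -/
def IsTerminating {A : Type} (R : Set (Word A × Word A)) : Prop :=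
  ¬ ∃ f : ℕ → Word A, ∀ n : ℕ, OneStep R (f n) (f (n + 1))

/-- The monoid presented by generators `A` and relations `R`: the quotient of the
free monoid on `A` by the congruence generated by `R`. -/
abbrev MonPres {A : Type} (R : Set (Word A × Word A)) : Type :=
  (conGen fun x y : Word A => (x, y) ∈ R).Quotient

/-- The canonical projection from words to the presented monoid. -/
def presMk {A : Type} (R : Set (Word A × Word A)) : Word A →* MonPres R :=
  Con.mk' _

/-- A two-letter alphabet. -/
inductive AB : Type | a | b

/-- A three-letter alphabet. -/
inductive ABX : Type | a | b | x


/-- The defining relation of `M = Mon⟨a,b : a^p b^(q+s) a^(pk) b^s = b⟩`. -/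
def relM (p s k q : ℕ) : Set (Word AB × Word AB) :=
  {((of AB.a)^p * (of AB.b)^(q+s) * (of AB.a)^(p*k) * (of AB.b)^s, of AB.b)}

/-- The element of `M` represented by the generator `a`. -/
def Am (p s k q : ℕ) : MonPres (relM p s k q) := presMk _ (of AB.a)

/-- The element of `M` represented by the generator `b`. -/
def Bm (p s k q : ℕ) : MonPres (relM p s k q) := presMk _ (of AB.b)

/-- The element `x` of `M` represented by the word `a^(pk) b^s`. -/
def Xm (p s k q : ℕ) : MonPres (relM p s k q) := presMk _ ((of AB.a)^(p*k) * (of AB.b)^s)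

/-- If `A b^(q+s) x = b`, then `A^j b` is reached from `A^(j+i) b` by right multiplication by
`(b^(q+s-1) x)^i`. -/
theorem pow_mul_mul_pow_eq {M : Type*} [Monoid M] {A b x : M} {q s : ℕ} (hs : 1 ≤ s)
    (h : A * b ^ (q + s) * x = b) (i j : ℕ) :
    A ^ (j + i) * b * (b ^ (q + s - 1) * x) ^ i = A ^ j * b := by
  have hb : b * b ^ (q + s - 1) = b ^ (q + s) := by
    rw [← pow_succ']
    congr 1
    omega
  induction i with
  | zero => simp
  | succ i ih =>
    calc A ^ (j + (i + 1)) * b * (b ^ (q + s - 1) * x) ^ (i + 1)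
        = A ^ (j + i) * (A * (b * b ^ (q + s - 1)) * x) * (b ^ (q + s - 1) * x) ^ i := by
          rw [← add_assoc, pow_succ A, pow_succ' (b ^ (q + s - 1) * x)]
          simp only [mul_assoc]
      _ = A ^ j * b := by rw [hb, h, ih]

/-- The consequence of `A b^(q+s) A^k b^s = b` in an arbitrary monoid, with `x = A^k b^s`. -/
theorem mul_mul_pow_eq_of_relation {M : Type*} [Monoid M] {A b x : M} {q s k : ℕ}
    (hs : 1 ≤ s) (hk : 1 ≤ k) (hq : s - 1 ≤ q) (hx : x = A ^ k * b ^ s)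
    (h : A * b ^ (q + s) * x = b) :
    A * x * b ^ (q + 1) =
      x * b ^ (q - (s - 1)) * x * (b ^ (q + s - 1) * x) ^ (k - 1) := by
  have hxx : x * b ^ q * x = A ^ (k - 1) * b := by
    calc x * b ^ q * x = A ^ (k - 1 + 1) * (b ^ s * b ^ q) * x := by
          rw [Nat.sub_add_cancel hk]
          nth_rewrite 1 [hx]
          simp only [mul_assoc]
      _ = A ^ (k - 1) * (A * b ^ (q + s) * x) := by
          rw [← pow_add, add_comm s q, pow_succ]
          simp only [mul_assoc]
      _ = A ^ (k - 1) * b := by rw [h]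
  have hb : b = x * b ^ q * x * (b ^ (q + s - 1) * x) ^ (k - 1) := by
    have := pow_mul_mul_pow_eq hs h (k - 1) 0
    rw [zero_add, pow_zero, one_mul] at this
    rw [hxx, this]
  have hA : A * (A ^ (k - 1) * b) = A ^ k * b := by
    rw [← mul_assoc, ← pow_succ', Nat.sub_add_cancel hk]
  have hxb : x * b ^ (q - (s - 1)) = A ^ k * b * b ^ q := by
    rw [hx, mul_assoc, ← pow_add, mul_assoc, ← pow_succ']
    congr 2
    omega
  calc A * x * b ^ (q + 1)
      = A * x * b ^ q * (x * b ^ q * x * (b ^ (q + s - 1) * x) ^ (k - 1)) := by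
        rw [← hb, pow_succ, mul_assoc, mul_assoc, mul_assoc]
    _ = A * (x * b ^ q * x) * b ^ q * x * (b ^ (q + s - 1) * x) ^ (k - 1) := by
        simp only [mul_assoc]
    _ = x * b ^ (q - (s - 1)) * x * (b ^ (q + s - 1) * x) ^ (k - 1) := by
        rw [hxx, hA, hxb]

/-- The defining relation of `M`. -/
theorem Am_pow_mul_Bm_pow_mul_Xm (p s k q : ℕ) :
    Am p s k q ^ p * Bm p s k q ^ (q + s) * Xm p s k q = Bm p s k q := by
  have h : presMk (relM p s k q)
      ((of AB.a) ^ p * (of AB.b) ^ (q + s) * (of AB.a) ^ (p * k) * (of AB.b) ^ s) =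
      presMk (relM p s k q) (of AB.b) :=
    (Con.eq _).2 (ConGen.Rel.of _ _ rfl)
  simpa only [Am, Bm, Xm, map_mul, map_pow, mul_assoc] using h

/-- In `M` with `q ≥ s - 1`, the equality `a^p x b^(q+1) = x b^(q-(s-1)) x (b^(q+s-1) x)^(k-1)` holds. -/
theorem stmt11 (p s k q : ℕ) (hp : 1 ≤ p) (hs : 2 ≤ s) (hk : 2 ≤ k) (hq : s - 1 ≤ q) :
    (Am p s k q)^p * (Xm p s k q) * (Bm p s k q)^(q+1) = (Xm p s k q) * (Bm p s k q)^(q-(s-1)) * (Xm p s k q) * ((Bm p s k q)^(q+s-1) * (Xm p s k q))^(k-1) := by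
  refine mul_mul_pow_eq_of_relation (by omega) (by omega) hq ?_ (Am_pow_mul_Bm_pow_mul_Xm p s k q)
  simp only [Am, Bm, Xm, map_mul, map_pow, pow_mul]
end

section
/- The monoid M = Mon⟨a,b : a b² a² b² = b⟩ is non-hopfian: there exists a monoid endomorphism φ : M → M that is surjective but not injective. -/
open Relation FreeMonoid

/-- The defining relation of `M = Mon⟨a,b : a b² a² b² = b⟩`. -/
def rel0 : Set (Word AB × Word AB) :=
  {((of AB.a) * (of AB.b)^2 * (of AB.a)^2 * (of AB.b)^2, of AB.b)}

/-- The element of `M` represented by the generator `a`. -/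
def A0 : MonPres rel0 := presMk _ (of AB.a)

/-- The element of `M` represented by the generator `b`. -/
def B0 : MonPres rel0 := presMk _ (of AB.b)

/-- Evaluation at `p`, `q` factors through `M` as soon as `p q² p² q² = q`. -/
def evalHom {N : Type*} [Monoid N] (p q : N) (h : p * q ^ 2 * p ^ 2 * q ^ 2 = q) :
    MonPres rel0 →* N :=
  Con.lift _ (FreeMonoid.lift fun | AB.a => p | AB.b => q) <| Con.conGen_le.2 fun x y hxy => by
    obtain ⟨rfl, rfl⟩ : x = _ ∧ y = _ := Prod.mk.inj hxy
    simpa [Con.ker_rel] using h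

theorem evalHom_A0 {N : Type*} [Monoid N] (p q : N) (h : p * q ^ 2 * p ^ 2 * q ^ 2 = q) :
    evalHom p q h A0 = p := rfl

theorem evalHom_B0 {N : Type*} [Monoid N] (p q : N) (h : p * q ^ 2 * p ^ 2 * q ^ 2 = q) :
    evalHom p q h B0 = q := rfl

section Relations

variable {N : Type*} [Monoid N] {p q : N}

theorem q_p_p_q_q (h : p * q ^ 2 * p ^ 2 * q ^ 2 = q) :
    q * p * p * q * q = p * q * q * p * q := by
  calc q * p * p * q * q = (p * q ^ 2 * p ^ 2 * q ^ 2) * p * p * q * q := by rw [h]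
    _ = p * q * q * p * (p * q ^ 2 * p ^ 2 * q ^ 2) := by simp only [pow_two, mul_assoc]
    _ = p * q * q * p * q := by rw [h]

theorem p_q_p_q_q_p_q (h : p * q ^ 2 * p ^ 2 * q ^ 2 = q) :
    p * q * p * q * q * p * q = q := by
  calc p * q * p * q * q * p * q = p * q * (p * q * q * p * q) := by simp only [mul_assoc]
    _ = p * q ^ 2 * p ^ 2 * q ^ 2 := by
      rw [← q_p_p_q_q h]; simp only [pow_two, mul_assoc]
    _ = q := h

theorem relation_q_p_q (h : p * q ^ 2 * p ^ 2 * q ^ 2 = q) :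
    p * (q * p * q) ^ 2 * p ^ 2 * (q * p * q) ^ 2 = q * p * q := by
  calc p * (q * p * q) ^ 2 * p ^ 2 * (q * p * q) ^ 2
      = (p * q * p * q * q * p * q) * p * (p * q * p * q * q * p * q) := by
        simp only [pow_two, mul_assoc]
    _ = q * p * q := by rw [p_q_p_q_q_p_q h]

theorem substituted_words_eq (h : p * q ^ 2 * p ^ 2 * q ^ 2 = q) :
    (q * p * q) * p ^ 3 * (q * p * q) ^ 3 = p ^ 2 * (q * p * q) ^ 3 * p * (q * p * q) := by
  calc (q * p * q) * p ^ 3 * (q * p * q) ^ 3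
      = q * p * q * p * p * (p * q * p * q * q * p * q) * q * p * q := by
        simp only [pow_succ, pow_zero, one_mul, mul_assoc]
    _ = q * p * (q * p * p * q * q) * p * q := by
        rw [p_q_p_q_q_p_q h]; simp only [mul_assoc]
    _ = q * p * (p * q * q * p * q) * p * q := by rw [q_p_p_q_q h]
    _ = (q * p * p * q * q) * p * q * p * q := by simp only [mul_assoc]
    _ = p * q * q * p * q * p * q * p * q := by rw [q_p_p_q_q h]
    _ = p * (p * q * p * q * q * p * q) * q * p * q * p * q * p * q := by
        rw [p_q_p_q_q_p_q h]
    _ = p ^ 2 * (q * p * q) ^ 3 * p * (q * p * q) := by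
        simp only [pow_succ, pow_zero, one_mul, mul_assoc]

end Relations

theorem relation_A0_B0 : A0 * B0 ^ 2 * A0 ^ 2 * B0 ^ 2 = B0 :=
  (Con.eq _).2 (ConGen.Rel.of _ _ rfl)

/-- `M` acts on `ℤ` with `a` acting by `n ↦ 2 - ⌊n / 2⌋` and `b` by `n ↦ -2 n`. -/
def intAction : MonPres rel0 →* Function.End ℤ :=
  evalHom (fun n : ℤ => 2 - n / 2 : Function.End ℤ) (fun n : ℤ => -2 * n : Function.End ℤ) <| by
    funext n
    change 2 - (-2 * (-2 * (2 - (2 - (-2 * (-2 * n)) / 2) / 2))) / 2 = -2 * n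
    omega

theorem words_ne : B0 * A0 ^ 3 * B0 ^ 3 ≠ A0 ^ 2 * B0 ^ 3 * A0 * B0 := by
  intro h
  have h0 : intAction (B0 * A0 ^ 3 * B0 ^ 3) 0 = intAction (A0 ^ 2 * B0 ^ 3 * A0 * B0) 0 := by
    rw [h]
  revert h0
  decide

/-- `M = Mon⟨a,b : a b² a² b² = b⟩` is non-hopfian: it has a surjective,
non-injective endomorphism. -/
theorem stmt17 :
    ∃ φ : MonPres rel0 →* MonPres rel0,
      Function.Surjective φ ∧ ¬ Function.Injective φ := by
  refine ⟨evalHom A0 (B0 * A0 * B0) (relation_q_p_q relation_A0_B0), ?_, fun hinj => ?_⟩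
  · rw [← MonoidHom.mrange_eq_top, eq_top_iff]
    rintro x -
    induction x using Con.induction_on with | _ w
    change presMk rel0 w ∈ _
    induction w using FreeMonoid.inductionOn' with
    | one => exact one_mem _
    | of_mul x w ih =>
      rw [map_mul]
      refine mul_mem ?_ ih
      cases x with
      | a => exact ⟨A0, rfl⟩
      | b =>
        refine ⟨A0 * B0 * B0, ?_⟩
        change _ = B0
        simpa only [map_mul, evalHom_A0, evalHom_B0, mul_assoc] using
          p_q_p_q_q_p_q relation_A0_B0
  · apply words_ne
    apply hinj
    simpa only [map_mul, map_pow, evalHom_A0, evalHom_B0] using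
      substituted_words_eq relation_A0_B0
end
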